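/- Let X ⊂ int(𝔸) be an essential annular continuum and assume that (V)₁ is unbounded from below and unbounded from above. Then for every R > 1 there exists L' < 0 such that: if γ is a hair of some V + k with k ≥ 0 whose image is contained in V⁺ and (γ(1))₁ ≤ L', then R ∈ (γ)₁. -/

import Mathlib

open Set Function MeasureTheory Filter Topology

noncomputable section

/-- The vertical fiber `[-1,1]`. -/
abbrev II : Set ℝ := Set.Icc (-1 : ℝ) 1

/-- The universal cover `ℝ × [-1,1]` of the annulus. -/
abbrev Strip : Type := ℝ × II

/-- The compact annulus `(ℝ/ℤ) × [-1,1]`. -/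
abbrev Ann : Type := AddCircle (1 : ℝ) × II

/-- The covering projection `π`. -/
def pr (z : Strip) : Ann := ((z.1 : AddCircle (1 : ℝ)), z.2)

/-- The deck transformation `T^k`. -/
def shiftPt (k : ℤ) (z : Strip) : Strip := (z.1 + k, z.2)

/-- `S + k`, the image of `S` under `T^k`. -/
def shiftSet (k : ℤ) (S : Set Strip) : Set Strip := shiftPt k '' S

/-- `f` is isotopic to the identity. -/
def IsotopicToId (f : Ann → Ann) : Prop :=
  ∃ H : ℝ → Ann → Ann, Continuous (fun p : ℝ × Ann => H p.1 p.2) ∧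
    (∀ t : ℝ, Function.Bijective (H t)) ∧ H 0 = id ∧ H 1 = f

/-- `F` is a lift of `f` commuting with the deck transformation. -/
def IsLift (f : Ann → Ann) (F : Strip → Strip) : Prop :=
  (∀ z, pr (F z) = f (pr z)) ∧ (∀ z, F (shiftPt 1 z) = shiftPt 1 (F z))

/-- `X` is an essential annular continuum with complementary components `Um`, `Up`. -/
structure IsEAC (X Um Up : Set Ann) : Prop where
  compact : IsCompact X
  connected : IsConnected X
  inInterior : ∀ p ∈ X, ((p.2 : ℝ)) ∈ Set.Ioo (-1 : ℝ) 1
  hUm : Um = connectedComponentIn Xᶜ ((0 : AddCircle (1 : ℝ)), ⟨-1, le_rfl, by norm_num⟩)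
  hUp : Up = connectedComponentIn Xᶜ ((0 : AddCircle (1 : ℝ)), ⟨1, by norm_num, le_rfl⟩)
  cover : Xᶜ = Um ∪ Up
  ne : Um ≠ Up

/-- An arc `γ : [0,1] → U ∪ {p}` with `γ([0,1)) ⊂ U` and `γ(1) = p`. -/
def IsArcTo (U : Set Strip) (γ : unitInterval → Strip) (p : Strip) : Prop :=
  Continuous γ ∧ Function.Injective γ ∧ (∀ t, t ≠ 1 → γ t ∈ U) ∧ γ 1 = p

/-- `p` is accessible from `U`. -/
def AccFrom (U : Set Strip) (p : Strip) : Prop := ∃ γ, IsArcTo U γ p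

/-- The order `≺` on accessible points, with access arcs starting on `ℝ × {b}`. -/
def PrecB (b : ℝ) (U : Set Strip) (x x' : Strip) : Prop :=
  ∃ γ γ' : unitInterval → Strip,
    IsArcTo U γ x ∧ IsArcTo U γ' x' ∧
    ((γ 0).2 : ℝ) = b ∧ ((γ' 0).2 : ℝ) = b ∧
    Disjoint (range γ) (range γ') ∧ (γ 0).1 < (γ' 0).1

/-- `k = k(x,y)` is the unique integer with `T^k(y) ⪯ x ≺ T^{k+1}(y)`. -/
def AccIdxB (b : ℝ) (U : Set Strip) (x y : Strip) (k : ℤ) : Prop :=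
  (shiftPt k y = x ∨ PrecB b U (shiftPt k y) x) ∧ PrecB b U x (shiftPt (k + 1) y)

/-- `ρ` is the prime end rotation number of the lift `F` as seen from `U`
(access arcs starting at height `b`): `k(Fⁿ(x), y)/n → ρ` for all accessible `x, y`. -/
def PrimeEndRotB (b : ℝ) (U Xt : Set Strip) (F : Strip → Strip) (ρ : ℝ) : Prop :=
  ∀ x ∈ Xt, ∀ y ∈ Xt, AccFrom U x → AccFrom U y →
    ∀ k : ℕ → ℤ, (∀ n : ℕ, AccIdxB b U (F^[n] x) y (k n)) →
      Tendsto (fun n : ℕ => (k n : ℝ) / (n : ℝ)) atTop (𝓝 ρ)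

/-- The measure-theoretic rotation set `ρ_mes(g̃, X)`, where `φ` is the displacement
function of the lift `g̃` (pushed down to the annulus). -/
def rotMes (g : Ann → Ann) (φ : Ann → ℝ) (X : Set Ann) : Set ℝ :=
  {r | ∃ μ : Measure Ann, IsProbabilityMeasure μ ∧ Measure.map g μ = μ ∧
    μ Xᶜ = 0 ∧ ∫ a, φ a ∂μ = r}

/-- A point in the interior of the top boundary segment `(0,1) × {1}`. -/
def topSeg : Strip := ((1 : ℝ) / 2, ⟨1, by norm_num, le_rfl⟩)

/-- `β' = β ∖ {x₀} = {0} × (η, 1]`. -/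
def betaP (η : ℝ) : Set Strip := {z : Strip | z.1 = 0 ∧ η < (z.2 : ℝ)}

/-- `η = max{y : (0,y) ∈ X̃}`. -/
def etaSpec (Xt : Set Strip) (η : ℝ) : Prop :=
  IsGreatest {y : ℝ | ∃ z ∈ Xt, z.1 = 0 ∧ (z.2 : ℝ) = y} η

/-- The fundamental region `V`: the closure, relative to `Ũ₊`, of the connected
component of `Ũ₊ ∖ (β' ∪ (β' + 1))` containing the segment `(0,1) × {1}`. -/
def Vset (Utp : Set Strip) (η : ℝ) : Set Strip :=
  Utp ∩ closure (connectedComponentIn (Utp \ (betaP η ∪ shiftSet 1 (betaP η))) topSeg)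

/-- A hair of `W`: an arc in `W` starting on `ℝ × {1}`. -/
def IsHair (W : Set Strip) (γ : unitInterval → Strip) : Prop :=
  Continuous γ ∧ Function.Injective γ ∧ ((γ 0).2 : ℝ) = 1 ∧ ∀ t, γ t ∈ W

/-- `(γ)₁`, the projection of the image of `γ` to the first coordinate. -/
def proj1 (γ : unitInterval → Strip) : Set ℝ := range fun t => (γ t).1

/-- `(V + k)⁻ = ⋃_{j ≤ k} (V + j)`. -/
def VMinus (k : ℤ) (V : Set Strip) : Set Strip := ⋃ j ∈ Iic k, shiftSet j V

/-- `(V + k)⁺ = ⋃_{j ≥ k} (V + j)`. -/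
def VPlus (k : ℤ) (V : Set Strip) : Set Strip := ⋃ j ∈ Ici k, shiftSet j V

/-- A crosscut of `Ũ₊`: an arc with endpoints on `X̃` and interior in `Ũ₊`. -/
def IsCrosscut (Utp Xt : Set Strip) (c : unitInterval → Strip) : Prop :=
  Continuous c ∧ Function.Injective c ∧ c 0 ∈ Xt ∧ c 1 ∈ Xt ∧
    ∀ t, t ≠ 0 → t ≠ 1 → c t ∈ Utp

/-- `F^n` for `n : ℤ`. -/
def iterZ (F : Strip ≃ₜ Strip) (n : ℤ) : Strip → Strip := fun z => (F.toEquiv ^ n) z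

end

/-- `f - z` has a continuous logarithm (up to a constant factor) with total increment `δ`. -/
def Wd (f : unitInterval → ℂ) (z δ : ℂ) : Prop :=
  ∃ θ : unitInterval → ℂ, Continuous θ ∧
    (∃ k : ℂ, k ≠ 0 ∧ ∀ t, Complex.exp (θ t) = k * (f t - z)) ∧ θ 1 - θ 0 = δ

lemma Wd.unique {f : unitInterval → ℂ} {z a b : ℂ} (ha : Wd f z a) (hb : Wd f z b) : a = b := by
  obtain ⟨θ, hθ, ⟨k, hk, h1⟩, rfl⟩ := ha
  obtain ⟨τ, hτ, ⟨l, hl, h2⟩, rfl⟩ := hb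
  have hne : ∀ t, f t - z ≠ 0 := by
    intro t h
    have := h1 t
    rw [h, mul_zero] at this
    exact Complex.exp_ne_zero _ this
  have hc : ∀ t, Complex.exp (θ t - τ t) = k / l := by
    intro t
    rw [Complex.exp_sub, h1, h2, mul_div_mul_right _ _ (hne t)]
  have := Complex.isCoveringMap_exp.eq_of_comp_eq (g₁ := fun t => θ t - τ t)
    (g₂ := fun _ => θ 0 - τ 0) (hθ.sub hτ) continuous_const
    (by funext t; simp [hc]) 0 rfl
  have h : θ 1 - τ 1 = θ 0 - τ 0 := congrFun this 1
  linear_combination h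

lemma Wd.exists {f : unitInterval → ℂ} (hf : Continuous f) {z : ℂ} (hz : ∀ t, f t ≠ z) :
    ∃ a, Wd f z a := by
  let g : C(unitInterval, {w : ℂ // w ≠ 0}) :=
    ⟨fun t => ⟨f t - z, sub_ne_zero.mpr (hz t)⟩, by fun_prop⟩
  obtain ⟨Γ, h, -⟩ := Complex.isCoveringMap_exp.exists_path_lifts g (Complex.log (f 0 - z))
    (by ext; simp [g, Complex.exp_log (sub_ne_zero.mpr (hz 0))])
  refine ⟨_, Γ, Γ.continuous, ⟨1, one_ne_zero, fun t => ?_⟩, rfl⟩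
  have := congrArg Subtype.val (congrFun h t)
  simpa [g] using this

lemma Wd.ne {f : unitInterval → ℂ} {z a : ℂ} (ha : Wd f z a) (t) : f t ≠ z := by
  obtain ⟨θ, hθ, ⟨k, hk, h1⟩, rfl⟩ := ha
  intro h
  have := h1 t
  rw [h, sub_self, mul_zero] at this
  exact Complex.exp_ne_zero _ this

lemma Wd.perturb {f : unitInterval → ℂ} (hf : Continuous f) {z a : ℂ} (ha : Wd f z a) :
    ∀ᶠ z' in 𝓝 z, Wd f z' (a + (Complex.log (1 + (z - z') / (f 1 - z))
      - Complex.log (1 + (z - z') / (f 0 - z)))) := by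
  have hne := ha.ne
  obtain ⟨θ, hθ, ⟨k, hk, h1⟩, rfl⟩ := ha
  have hpos : ∃ r > 0, ∀ t, r ≤ ‖f t - z‖ := by
    obtain ⟨t, -, ht⟩ := isCompact_univ.exists_isMinOn (univ_nonempty (α := unitInterval))
      (f := fun t => ‖f t - z‖) (by fun_prop)
    exact ⟨‖f t - z‖, norm_pos_iff.mpr (sub_ne_zero.mpr (hne t)), fun s => ht (mem_univ s)⟩
  obtain ⟨r, hr, hle⟩ := hpos
  filter_upwards [Metric.ball_mem_nhds z hr] with z' hz'
  have hsm : ∀ t, ‖(z - z') / (f t - z)‖ < 1 := by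
    intro t
    have h0 := lt_of_lt_of_le hr (hle t)
    rw [norm_div, div_lt_one h0, norm_sub_rev, ← dist_eq_norm]
    exact lt_of_lt_of_le hz' (hle t)
  have hsl : ∀ t, 1 + (z - z') / (f t - z) ∈ Complex.slitPlane := fun t =>
    Complex.mem_slitPlane_of_norm_lt_one (hsm t)
  refine ⟨fun t => θ t + Complex.log (1 + (z - z') / (f t - z)), ?_, ⟨k, hk, fun t => ?_⟩, by ring⟩
  · refine hθ.add (Continuous.clog ?_ hsl)
    exact continuous_const.add (continuous_const.div (hf.sub continuous_const)
      fun t => sub_ne_zero.mpr (hne t))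
  · rw [Complex.exp_add, h1, Complex.exp_log (Complex.slitPlane_ne_zero (hsl t))]
    have := sub_ne_zero.mpr (hne t)
    field_simp
    ring

/-- the loop made of `p` and `c` has winding number zero around `z` -/
def WZ (p c : unitInterval → ℂ) (z : ℂ) : Prop := ∃ a b, Wd p z a ∧ Wd c z b ∧ a + b = 0
/-- the loop made of `p` and `c` has nonzero winding number around `z` -/
def WN (p c : unitInterval → ℂ) (z : ℂ) : Prop := ∃ a b, Wd p z a ∧ Wd c z b ∧ a + b ≠ 0

lemma WZ_WN {p c : unitInterval → ℂ} {z : ℂ} (h : WZ p c z) (h' : WN p c z) : False := by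
  obtain ⟨a, b, h1, h2, h3⟩ := h
  obtain ⟨a', b', h1', h2', h3'⟩ := h'
  rw [h1.unique h1', h2.unique h2'] at h3
  exact h3' h3

lemma WZ_or_WN {p c : unitInterval → ℂ} (hp : Continuous p) (hc : Continuous c) {z : ℂ}
    (h1 : ∀ t, p t ≠ z) (h2 : ∀ t, c t ≠ z) : WZ p c z ∨ WN p c z := by
  obtain ⟨a, ha⟩ := Wd.exists hp h1
  obtain ⟨b, hb⟩ := Wd.exists hc h2
  by_cases h : a + b = 0
  · exact .inl ⟨a, b, ha, hb, h⟩
  · exact .inr ⟨a, b, ha, hb, h⟩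

lemma isOpen_WZ {p c : unitInterval → ℂ} (hp : Continuous p) (hc : Continuous c)
    (h01 : p 1 = c 0) (h10 : c 1 = p 0) : IsOpen {z | WZ p c z} := by
  rw [isOpen_iff_mem_nhds]
  rintro z ⟨a, b, ha, hb, hab⟩
  filter_upwards [ha.perturb hp, hb.perturb hc] with z' h1 h2
  refine ⟨_, _, h1, h2, ?_⟩
  rw [h01, h10]
  linear_combination hab

lemma isOpen_WN {p c : unitInterval → ℂ} (hp : Continuous p) (hc : Continuous c)
    (h01 : p 1 = c 0) (h10 : c 1 = p 0) : IsOpen {z | WN p c z} := by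
  rw [isOpen_iff_mem_nhds]
  rintro z ⟨a, b, ha, hb, hab⟩
  filter_upwards [ha.perturb hp, hb.perturb hc] with z' h1 h2
  refine ⟨_, _, h1, h2, fun h => hab ?_⟩
  rw [h01, h10] at h
  linear_combination h

lemma Wd_log {f : unitInterval → ℂ} (hf : Continuous f) {z k : ℂ} (hk : k ≠ 0)
    (h : ∀ t, k * (f t - z) ∈ Complex.slitPlane) :
    Wd f z (Complex.log (k * (f 1 - z)) - Complex.log (k * (f 0 - z))) :=
  ⟨fun t => Complex.log (k * (f t - z)), Continuous.clog (by fun_prop) h,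
    ⟨k, hk, fun t => Complex.exp_log (Complex.slitPlane_ne_zero (h t))⟩, rfl⟩

lemma WZ_of_slit {p c : unitInterval → ℂ} (hp : Continuous p) (hc : Continuous c)
    (h01 : p 1 = c 0) (h10 : c 1 = p 0) {z k : ℂ} (hk : k ≠ 0)
    (h1 : ∀ t, k * (p t - z) ∈ Complex.slitPlane) (h2 : ∀ t, k * (c t - z) ∈ Complex.slitPlane) :
    WZ p c z :=
  ⟨_, _, Wd_log hp hk h1, Wd_log hc hk h2, by rw [h01, h10]; ring⟩

/-- `p` goes below `z` from right to left, `c` goes back above `z`. -/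
lemma WN_of_cross {p c : unitInterval → ℂ} (hp : Continuous p) (hc : Continuous c)
    (h01 : p 1 = c 0) (h10 : c 1 = p 0) {z : ℂ}
    (h1 : ∀ t, (p t).re = z.re → (p t).im < z.im) (h2 : ∀ t, (c t).re = z.re → z.im < (c t).im)
    (h0 : z.re < (p 0).re) (h3 : (p 1).re < z.re) : WN p c z := by
  refine ⟨_, _, Wd_log hp (k := Complex.I) Complex.I_ne_zero ?_,
    Wd_log hc (k := -Complex.I) (neg_ne_zero.mpr Complex.I_ne_zero) ?_, ?_⟩
  · intro t
    rw [Complex.mem_slitPlane_iff]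
    by_cases h : (p t).re = z.re
    · left; have := h1 t h; simp; linarith
    · right; simpa [sub_eq_zero] using h
  · intro t
    rw [Complex.mem_slitPlane_iff]
    by_cases h : (c t).re = z.re
    · left; have := h2 t h; simp; linarith
    · right; simpa [sub_eq_zero, eq_comm] using h
  · rw [h10, ← h01]
    intro h
    have h := congrArg Complex.im h
    simp only [neg_mul, Complex.add_im, Complex.sub_im, Complex.log_im, Complex.zero_im] at h
    rw [Complex.arg_neg_eq_arg_sub_pi_of_im_pos (by simp; linarith),
      Complex.arg_neg_eq_arg_add_pi_of_im_neg (by simp; linarith)] at h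
    have := Real.pi_pos
    linarith

/-- The embedding of the strip in the plane. -/
def emb (z : Strip) : ℂ := ⟨z.1, (z.2 : ℝ)⟩

lemma continuous_emb : Continuous emb := by
  have : emb = fun z : Strip => (z.1 : ℂ) + ((z.2 : ℝ) : ℂ) * Complex.I := by
    funext z; apply Complex.ext <;> simp [emb]
  rw [this]
  fun_prop

lemma emb_inj {z w : Strip} (h : emb z = emb w) : z = w := by
  have h1 := congrArg Complex.re h
  have h2 := congrArg Complex.im h
  exact Prod.ext h1 (Subtype.ext h2)

/-- the point `(x, 1)` -/
def tp (x : ℝ) : Strip := (x, ⟨1, by norm_num, le_rfl⟩)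

lemma continuous_tp : Continuous tp := by unfold tp; fun_prop

lemma continuous_pr : Continuous pr := by
  unfold pr
  exact ((AddCircle.continuous_mk' 1).comp continuous_fst).prodMk continuous_snd

lemma isOpenMap_pr : IsOpenMap pr := by
  have : IsOpenMap (Prod.map (fun x : ℝ => (x : AddCircle (1 : ℝ))) (id : II → II)) :=
    (QuotientAddGroup.isOpenMap_coe).prodMap IsOpenMap.id
  exact this

lemma pr_surj : Function.Surjective pr := by
  rintro ⟨a, b⟩
  obtain ⟨x, rfl⟩ := QuotientAddGroup.mk_surjective a
  exact ⟨(x, b), rfl⟩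

lemma pr_shift (k : ℤ) (z : Strip) : pr (shiftPt k z) = pr z := by
  unfold pr shiftPt
  ext
  · simp only
    have : ((k : ℝ) : AddCircle (1 : ℝ)) = 0 := by
      rw [AddCircle.coe_eq_zero_iff]; exact ⟨k, by simp⟩
    rw [AddCircle.coe_add, this, add_zero]
  · rfl

lemma continuous_shiftPt (k : ℤ) : Continuous (shiftPt k) := by unfold shiftPt; fun_prop

instance : LocallyPathConnectedSpace II := (convex_Icc (-1 : ℝ) 1).locallyPathConnectedSpace
instance : PreconnectedSpace II := Subtype.preconnectedSpace isPreconnected_Icc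
instance : LocallyPathConnectedSpace (AddCircle (1 : ℝ)) :=
  (QuotientAddGroup.isOpenQuotientMap_mk (G := ℝ)
    (N := AddSubgroup.zmultiples (1 : ℝ))).isQuotientMap.locallyPathConnectedSpace

instance : PreconnectedSpace Ann :=
  ⟨by rw [← pr_surj.range_eq]; exact isPreconnected_range continuous_pr⟩

namespace IsEAC

lemma isOpenXc {X Um Up : Set Ann} (hX : IsEAC X Um Up) : IsOpen Xᶜ := hX.compact.isClosed.isOpen_compl

lemma isOpenUp {X Um Up : Set Ann} (hX : IsEAC X Um Up) : IsOpen Up := by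
  rw [hX.hUp]; exact hX.isOpenXc.connectedComponentIn

lemma isOpenUm {X Um Up : Set Ann} (hX : IsEAC X Um Up) : IsOpen Um := by
  rw [hX.hUm]; exact hX.isOpenXc.connectedComponentIn

lemma disj {X Um Up : Set Ann} (hX : IsEAC X Um Up) : Disjoint Um Up := by
  rw [Set.disjoint_left]
  intro z h1 h2
  apply hX.ne
  rw [hX.hUm] at h1 ⊢
  rw [hX.hUp] at h2 ⊢
  rw [connectedComponentIn_eq h1, connectedComponentIn_eq h2]

lemma subUp {X Um Up : Set Ann} (hX : IsEAC X Um Up) {S : Set Strip} (hS : IsPreconnected S) (hSX : ∀ z ∈ S, pr z ∉ X)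
    (h0 : tp 0 ∈ S) : S ⊆ pr ⁻¹' Up := by
  rw [← Set.image_subset_iff, hX.hUp]
  refine (hS.image _ continuous_pr.continuousOn).subset_connectedComponentIn
    ⟨tp 0, h0, by simp [pr, tp]⟩ ?_
  rintro _ ⟨z, hz, rfl⟩
  exact hSX z hz

lemma top_mem {X Um Up : Set Ann} (hX : IsEAC X Um Up) (x : ℝ) : pr (tp x) ∈ Up := by
  refine hX.subUp (S := range tp) (isPreconnected_range continuous_tp) ?_ ⟨0, rfl⟩ ⟨x, rfl⟩
  rintro _ ⟨y, rfl⟩ h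
  have := (hX.inInterior _ h).2
  simp [pr, tp] at this

lemma bot_mem {X Um Up : Set Ann} (hX : IsEAC X Um Up) (z : Strip) (hz : (z.2 : ℝ) = -1) : pr z ∉ Up := by
  intro h
  have hm : pr z ∈ Um := by
    have hc : Continuous (fun x : ℝ => pr (x, z.2)) := continuous_pr.comp (by fun_prop)
    rw [hX.hUm]
    refine (isPreconnected_range hc).subset_connectedComponentIn
      ⟨0, ?_⟩ ?_ ⟨z.1, rfl⟩
    · simp only [pr]
      ext
      · simp
      · simp [hz]
    · rintro _ ⟨x, rfl⟩ h
      have := (hX.inInterior _ h).1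
      simp [pr, hz] at this
  exact Set.disjoint_left.mp hX.disj hm h

lemma X_not_Up {X Um Up : Set Ann} (hX : IsEAC X Um Up) {a : Ann} (h : a ∈ X) : a ∉ Up := by
  intro h'
  have : a ∈ Xᶜ := by rw [hX.cover]; exact .inr h'
  exact this h

lemma aux {X Um Up : Set Ann} (hX : IsEAC X Um Up) {u v : Set Ann} (hu : IsClosed u) (hv : IsClosed v) (huv : Upᶜ ⊆ u ∪ v)
    (hne : (Upᶜ ∩ v).Nonempty) (hX' : X ⊆ u) : (Upᶜ ∩ (u ∩ v)).Nonempty := by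
  by_contra hcon
  rw [Set.not_nonempty_iff_eq_empty, Set.eq_empty_iff_forall_notMem] at hcon
  have hC : Upᶜ ∩ v = Um \ u := by
    ext a
    constructor
    · rintro ⟨h1, h2⟩
      have hau : a ∉ u := fun h => hcon a ⟨h1, h, h2⟩
      have : a ∈ Um ∪ Up := by rw [← hX.cover]; exact fun h => hau (hX' h)
      exact ⟨this.resolve_right h1, hau⟩
    · rintro ⟨h1, h2⟩
      have h3 : a ∈ Upᶜ := Set.disjoint_left.mp hX.disj h1
      exact ⟨h3, (huv h3).resolve_left h2⟩
  have hcl : IsClopen (Upᶜ ∩ v) :=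
    ⟨hX.isOpenUp.isClosed_compl.inter hv, by
      rw [hC]; exact hX.isOpenUm.sdiff hu⟩
  have := hcl.eq_univ hne
  have h0 : pr (tp 0) ∈ Upᶜ ∩ v := by rw [this]; trivial
  exact h0.1 (hX.top_mem 0)

lemma preconn {X Um Up : Set Ann} (hX : IsEAC X Um Up) : IsPreconnected Upᶜ := by
  rw [isPreconnected_closed_iff]
  intro u v hu hv huv h1 h2
  by_contra hcon
  have hsub : X ⊆ Upᶜ := fun a ha => hX.X_not_Up ha
  have : X ∩ (u ∩ v) = ∅ := by
    rw [Set.eq_empty_iff_forall_notMem]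
    rintro a ⟨ha, hb⟩
    exact hcon ⟨a, hsub ha, hb⟩
  rcases isPreconnected_iff_subset_of_disjoint_closed.mp hX.connected.isPreconnected u v hu hv
    (hsub.trans huv) this with h | h
  · exact hcon (hX.aux hu hv huv h2 h)
  · exact hcon (by rw [Set.inter_comm u v]; exact hX.aux hv hu (by rwa [Set.union_comm]) h1 h)

lemma betaP_preconn {X Um Up : Set Ann} (hX : IsEAC X Um Up) {η : ℝ} (hη : etaSpec (pr ⁻¹' X) η) : IsPreconnected (betaP η) := by
  obtain ⟨h2, h1⟩ : -1 < η ∧ η < 1 := by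
    obtain ⟨z, hz, -, rfl⟩ := hη.1
    exact hX.inInterior _ hz
  have : betaP η = ({0} : Set ℝ) ×ˢ {y : II | η < (y : ℝ)} := by
    ext ⟨x, y⟩; simp [betaP]
  rw [this]
  refine isPreconnected_singleton.prod ?_
  rw [← Topology.IsInducing.subtypeVal.isPreconnected_image]
  have : Subtype.val '' {y : II | η < (y : ℝ)} = Ioc η 1 := by
    ext y
    constructor
    · rintro ⟨y, hy, rfl⟩
      exact ⟨hy, y.2.2⟩
    · rintro ⟨h3, h4⟩
      exact ⟨⟨y, by linarith, h4⟩, h3, rfl⟩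
  rw [this]
  exact isPreconnected_Ioc

lemma colU {X Um Up : Set Ann} (hX : IsEAC X Um Up) {η : ℝ} (hη : etaSpec (pr ⁻¹' X) η) : betaP η ⊆ pr ⁻¹' Up := by
  obtain ⟨h2, h1⟩ : -1 < η ∧ η < 1 := by
    obtain ⟨z, hz, -, rfl⟩ := hη.1
    exact hX.inInterior _ hz
  refine hX.subUp ?_ ?_ ⟨rfl, h1⟩
  · exact hX.betaP_preconn hη
  · rintro z ⟨hz, hy⟩ hzX
    exact absurd (hη.2 ⟨z, hzX, hz, rfl⟩) (not_le.mpr hy)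

/-- `β'` separates the two sides of `Ũ₊`. -/
lemma sep {X Um Up : Set Ann} (hX : IsEAC X Um Up) {η : ℝ} (hη : etaSpec (pr ⁻¹' X) η) :
    ¬ JoinedIn (pr ⁻¹' Up \ betaP η) (tp (1/2)) (tp (-1/2)) := by
  rintro ⟨P, hP⟩
  let p : unitInterval → ℂ := fun t => emb (P t)
  let c : unitInterval → ℂ := fun t => emb (tp (-1/2 + (t : ℝ)))
  have hp : Continuous p := continuous_emb.comp P.continuous
  have hc : Continuous c := continuous_emb.comp (continuous_tp.comp (by fun_prop))
  have h01 : p 1 = c 0 := by simp [p, c]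
  have h10 : c 1 = p 0 := by simp [p, c]; norm_num
  have hp0 : (p 0).re = 1/2 := by simp only [p, P.source]; rfl
  have hp1 : (p 1).re = -1/2 := by simp only [p, P.target]; rfl
  obtain ⟨M, hM⟩ := isCompact_univ.exists_bound_of_continuousOn
    (f := fun t : unitInterval => (p t).re) (Complex.continuous_re.comp hp).continuousOn
  have hM1 : 1/2 ≤ M := by
    have := hM 0 trivial
    rw [hp0] at this
    exact (le_abs_self _).trans this
  have hpM : ∀ t, |(p t).re| ≤ M := fun t => hM t trivial
  have hcM : ∀ t, |(c t).re| ≤ M := by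
    intro t
    have h1 := t.2.1
    have h2 := t.2.2
    simp only [c, emb, tp]
    rw [abs_le]; constructor <;> linarith
  have hO : IsOpen {z : Strip | WN p c (emb z)} := (isOpen_WN hp hc h01 h10).preimage continuous_emb
  have hZ : IsOpen {z : Strip | WZ p c (emb z)} := (isOpen_WZ hp hc h01 h10).preimage continuous_emb
  have hor : ∀ z : Strip, pr z ∉ Up → WZ p c (emb z) ∨ WN p c (emb z) := by
    intro z hz
    refine WZ_or_WN hp hc ?_ ?_
    · intro t h
      rw [← emb_inj h] at hz
      exact hz (hP t).1
    · intro t h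
      rw [← emb_inj h] at hz
      exact hz (hX.top_mem _)
  set K : Set Strip := (pr ⁻¹' Up)ᶜ ∩ {z : Strip | WZ p c (emb z)}ᶜ with hK
  have hKc : IsClosed K :=
    (hX.isOpenUp.preimage continuous_pr).isClosed_compl.inter hZ.isClosed_compl
  have hKb : K ⊆ Icc (-M) M ×ˢ univ := by
    rintro z ⟨-, hz⟩
    refine ⟨?_, trivial⟩
    by_contra hcon
    apply hz
    rw [Set.mem_Icc, not_and_or, not_le, not_le] at hcon
    rcases hcon with h | h
    · refine WZ_of_slit hp hc h01 h10 (k := 1) one_ne_zero ?_ ?_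
      all_goals
        intro t
        have h1 := abs_le.mp (hpM t)
        have h2 := abs_le.mp (hcM t)
        rw [Complex.mem_slitPlane_iff]; left
        simp only [one_mul, Complex.sub_re, emb]
        simp only [emb, p, c] at h1 h2 ⊢
        linarith
    · refine WZ_of_slit hp hc h01 h10 (k := -1) (by norm_num) ?_ ?_
      all_goals
        intro t
        have h1 := abs_le.mp (hpM t)
        have h2 := abs_le.mp (hcM t)
        rw [Complex.mem_slitPlane_iff]; left
        simp only [neg_mul, one_mul, Complex.neg_re, Complex.sub_re, emb]
        simp only [emb, p, c] at h1 h2 ⊢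
        linarith
  have hKk : IsCompact K := (isCompact_Icc.prod isCompact_univ).of_isClosed_subset hKc hKb
  have hD : IsClosed (pr '' K) := (hKk.image continuous_pr).isClosed
  have hKO : ∀ z, pr z ∉ Up → WN p c (emb z) → z ∈ K := fun z h1 h2 =>
    ⟨h1, fun h => WZ_WN h h2⟩
  obtain ⟨x0, hx0, hx0z, hx0y⟩ := hη.1
  have hx0K : x0 ∈ K := by
    refine hKO _ (hX.X_not_Up hx0) (WN_of_cross hp hc h01 h10 ?_ ?_ ?_ ?_)
    · intro t ht
      have hre : (P t).1 = 0 := by rw [← hx0z]; exact ht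
      by_contra hlt
      rw [not_lt] at hlt
      have h1 : (x0.2 : ℝ) ≤ ((P t).2 : ℝ) := hlt
      rcases h1.eq_or_lt with h | h
      · have : P t = x0 := Prod.ext (by rw [hre, hx0z]) (Subtype.ext h.symm)
        have h2 := (hP t).1
        rw [this] at h2
        exact hX.X_not_Up hx0 h2
      · exact (hP t).2 ⟨hre, by rwa [← hx0y]⟩
    · intro t _
      exact (hX.inInterior _ hx0).2
    · rw [hp0]; simp [emb, hx0z]
    · rw [hp1]; simp only [emb, hx0z]; norm_num
  obtain ⟨a, haU, ⟨z, hz, rfl⟩, haD⟩ := hX.preconn (pr '' {z : Strip | WN p c (emb z)}) (pr '' K)ᶜ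
    (isOpenMap_pr _ hO) hD.isOpen_compl (by
      intro a ha
      by_cases h : a ∈ pr '' K
      · left
        obtain ⟨z, hz, rfl⟩ := h
        exact ⟨z, (hor z hz.1).resolve_left hz.2, rfl⟩
      · right; exact h)
    ⟨pr x0, hx0K.1, x0, (hor x0 hx0K.1).resolve_left hx0K.2, rfl⟩ (by
      let b : Strip := (0, ⟨-1, le_rfl, by norm_num⟩)
      refine ⟨pr b, hX.bot_mem b rfl, ?_⟩
      rintro ⟨z, hz, hzb⟩
      have hz2 : (z.2 : ℝ) = -1 := by
        have := congrArg Prod.snd hzb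
        simp only [pr] at this
        rw [this]
      apply hz.2
      have hlow : ∀ w : Strip, pr w ∈ Up → -1 < (w.2 : ℝ) := by
        intro w hw
        exact lt_of_le_of_ne w.2.2.1 fun h => hX.bot_mem w h.symm hw
      refine WZ_of_slit hp hc h01 h10 (k := -Complex.I) (by simp) ?_ ?_
      · intro t
        have := hlow _ (hP t).1
        rw [Complex.mem_slitPlane_iff]; left
        simp [p, emb, hz2]; linarith
      · intro t
        have := hlow _ (hX.top_mem (-1/2 + (t : ℝ)))
        rw [Complex.mem_slitPlane_iff]; left
        simp [c, emb, hz2]; linarith)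
  exact haD ⟨z, hKO z haU hz, rfl⟩

end IsEAC
lemma betaP_top {η : ℝ} {x : ℝ} (hx : x ≠ 0) : tp x ∉ betaP η := fun h => hx h.1

/-- Lemma `pasaporderecha`: for every `R > 1` there is `L' < 0` such that
any hair of a translate `V + k`, `k ≥ 0` (hence contained in `V⁺`), whose endpoint lies to
the left of `L'` passes over `R`. -/
theorem hair_passes_right
    (X Um Up : Set Ann) (hX : IsEAC X Um Up)
    (η : ℝ) (hη : etaSpec (pr ⁻¹' X) η)
    (hbelow : ¬ BddBelow (Prod.fst '' Vset (pr ⁻¹' Up) η))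
    (habove : ¬ BddAbove (Prod.fst '' Vset (pr ⁻¹' Up) η)) :
    ∀ R : ℝ, R > 1 → ∃ L' : ℝ, L' < 0 ∧
      ∀ k : ℤ, 0 ≤ k → ∀ γ : unitInterval → Strip,
        IsHair (shiftSet k (Vset (pr ⁻¹' Up) η)) γ → (γ 1).1 ≤ L' → R ∈ proj1 γ := by
  intro R hR
  set Ut : Set Strip := pr ⁻¹' Up with hUt
  have hsh : ∀ (k : ℤ) (z : Strip), z ∈ Ut → shiftPt k z ∈ Ut := by
    intro k z hz
    change pr (shiftPt k z) ∈ Up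
    rw [pr_shift]; exact hz
  have hUo : IsOpen Ut := hX.isOpenUp.preimage continuous_pr
  have hW : IsOpen (Ut \ betaP η) := by
    have : Ut \ betaP η = Ut \ {z : Strip | z.1 = 0 ∧ η ≤ (z.2 : ℝ)} := by
      ext z
      constructor
      · rintro ⟨h1, h2⟩
        refine ⟨h1, fun ⟨h3, h4⟩ => ?_⟩
        rcases h4.eq_or_lt with h | h
        · obtain ⟨x0, hx0, hx0z, hx0y⟩ := hη.1
          have : z = x0 := Prod.ext (by rw [h3, hx0z]) (Subtype.ext (by rw [← h, hx0y]))
          rw [this] at h1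
          exact hX.X_not_Up hx0 h1
        · exact h2 ⟨h3, h⟩
      · rintro ⟨h1, h2⟩
        exact ⟨h1, fun ⟨h3, h4⟩ => h2 ⟨h3, h4.le⟩⟩
    rw [this]
    refine hUo.sdiff ?_
    exact (isClosed_eq continuous_fst continuous_const).inter
      (isClosed_le continuous_const (continuous_subtype_val.comp continuous_snd))
  set Lf := connectedComponentIn (Ut \ betaP η) (tp (-1/2)) with hLf
  set Rt := connectedComponentIn (Ut \ betaP η) (tp (1/2)) with hRt
  have hLm : tp (-1/2) ∈ Ut \ betaP η := ⟨hX.top_mem _, betaP_top (by norm_num)⟩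
  have hRm : tp (1/2) ∈ Ut \ betaP η := ⟨hX.top_mem _, betaP_top (by norm_num)⟩
  have hLo : IsOpen Lf := hW.connectedComponentIn
  have hRo : IsOpen Rt := hW.connectedComponentIn
  have hLp : IsPathConnected Lf := hLo.isConnected_iff_isPathConnected.mp
    (isConnected_connectedComponentIn_iff.mpr hLm)
  have hRp : IsPathConnected Rt := hRo.isConnected_iff_isPathConnected.mp
    (isConnected_connectedComponentIn_iff.mpr hRm)
  have hLs : Lf ⊆ Ut \ betaP η := connectedComponentIn_subset _ _
  have hRs : Rt ⊆ Ut \ betaP η := connectedComponentIn_subset _ _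
  have hLR : ∀ z, z ∈ Lf → z ∈ Rt → False := by
    intro z h1 h2
    apply hX.sep hη
    have j1 := (hRp.joinedIn _ (mem_connectedComponentIn hRm) _ h2).mono hRs
    have j2 := (hLp.joinedIn _ h1 _ (mem_connectedComponentIn hLm)).mono hLs
    exact j1.trans j2
  have hLtop : ∀ x < 0, tp x ∈ Lf := by
    intro x hx
    have : tp '' Iio 0 ⊆ Lf := by
      refine (isPreconnected_Iio.image _ continuous_tp.continuousOn).subset_connectedComponentIn
        ⟨-1/2, by norm_num, rfl⟩ ?_
      rintro _ ⟨y, hy, rfl⟩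
      exact ⟨hX.top_mem _, betaP_top (ne_of_lt hy)⟩
    exact this ⟨x, hx, rfl⟩
  have hRtop : ∀ x > 0, tp x ∈ Rt := by
    intro x hx
    have : tp '' Ioi 0 ⊆ Rt := by
      refine (isPreconnected_Ioi.image _ continuous_tp.continuousOn).subset_connectedComponentIn
        ⟨1/2, by norm_num, rfl⟩ ?_
      rintro _ ⟨y, hy, rfl⟩
      exact ⟨hX.top_mem _, betaP_top (ne_of_gt hy)⟩
    exact this ⟨x, hx, rfl⟩
  set V0 := connectedComponentIn (Ut \ (betaP η ∪ shiftSet 1 (betaP η))) topSeg with hV0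
  have hV0s : V0 ⊆ Ut \ (betaP η ∪ shiftSet 1 (betaP η)) := connectedComponentIn_subset _ _
  have hV0p : IsPreconnected V0 := isPreconnected_connectedComponentIn
  have htS : topSeg ∈ V0 := by
    refine mem_connectedComponentIn ⟨hX.top_mem (1/2), ?_⟩
    rintro (h | ⟨z, hz, h⟩)
    · exact betaP_top (x := 1/2) (by norm_num) h
    · have h := congrArg Prod.fst h
      simp only [shiftPt, topSeg, hz.1] at h
      norm_num at h
  have hV0R : V0 ⊆ Rt := hV0p.subset_connectedComponentIn htS
    fun z hz => ⟨(hV0s hz).1, fun h => (hV0s hz).2 (.inl h)⟩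
  have hη1 : η < 1 := by
    obtain ⟨z, hz, -, rfl⟩ := hη.1
    exact (hX.inInterior _ hz).2
  have hbpre : IsPreconnected (betaP η) := hX.betaP_preconn hη
  -- translates of `β'` to the left lie in `Lf`
  have hbL : ∀ k : ℤ, 0 < k → shiftPt (-k) '' betaP η ⊆ Lf := by
    intro k hk
    have hk' : (0 : ℝ) < k := by exact_mod_cast hk
    have hm := mem_connectedComponentIn
      (hLs (hLtop (-(k : ℝ)) (by linarith)))
    rw [← connectedComponentIn_eq (hLtop (-(k : ℝ)) (by linarith))] at hm
    rw [hLf, connectedComponentIn_eq hm]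
    refine (hbpre.image _ (continuous_shiftPt _).continuousOn).subset_connectedComponentIn
      ⟨tp 0, ⟨rfl, hη1⟩, by simp [shiftPt, tp]⟩ ?_
    rintro _ ⟨z, hz, rfl⟩
    refine ⟨hsh _ _ (hX.colU hη hz), fun h => ?_⟩
    have := h.1
    simp only [shiftPt, hz.1] at this
    push_cast at this
    linarith
  have hV0k : ∀ k : ℤ, 0 ≤ k → shiftPt k '' V0 ⊆ Rt := by
    intro k hk
    have hk' : (0 : ℝ) ≤ k := by exact_mod_cast hk
    have hm := hRtop (1/2 + (k : ℝ)) (by linarith)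
    rw [hRt, connectedComponentIn_eq hm]
    refine (hV0p.image _ (continuous_shiftPt _).continuousOn).subset_connectedComponentIn
      ⟨topSeg, htS, rfl⟩ ?_
    rintro _ ⟨z, hz, rfl⟩
    refine ⟨hsh _ _ (hV0s hz).1, fun h => ?_⟩
    rcases hk.eq_or_lt with rfl | hk0
    · refine (hV0s hz).2 (.inl ?_)
      simpa [shiftPt] using h
    · refine hLR z (hbL k hk0 ⟨_, h, ?_⟩) (hV0R hz)
      simp [shiftPt]
  have hV0L : shiftPt (-1) '' V0 ⊆ Lf := by
    refine (hV0p.image _ (continuous_shiftPt _).continuousOn).subset_connectedComponentIn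
      ⟨topSeg, htS, ?_⟩ ?_
    · simp only [shiftPt, topSeg, tp]
      ext
      · norm_num
      · rfl
    · rintro _ ⟨z, hz, rfl⟩
      refine ⟨hsh _ _ (hV0s hz).1, fun h => (hV0s hz).2 (.inr ⟨_, h, ?_⟩)⟩
      simp [shiftPt]
  have hVk : ∀ k : ℤ, 0 ≤ k → ∀ z ∈ shiftSet k (Vset Ut η), z ∉ Lf := by
    rintro k hk _ ⟨z, hz, rfl⟩ hzL
    obtain ⟨w, hw1, hw2⟩ := mem_closure_iff.mp hz.2 _
      (hLo.preimage (continuous_shiftPt k)) hzL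
    exact hLR _ hw1 (hV0k k hk ⟨w, hw2, rfl⟩)
  -- a path in `Lf` reaching beyond `R`
  obtain ⟨w, hwL, hwR⟩ : ∃ w ∈ Lf, R < w.1 := by
    rw [not_bddAbove_iff] at habove
    obtain ⟨_, ⟨z, hz, rfl⟩, hzR⟩ := habove (R + 1)
    obtain ⟨w, hw1, hw2⟩ := mem_closure_iff.mp hz.2 _
      (isOpen_Ioi.preimage continuous_fst) (show z ∈ Prod.fst ⁻¹' Ioi (R + 1) from hzR)
    refine ⟨_, hV0L ⟨w, hw2, rfl⟩, ?_⟩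
    have : R + 1 < w.1 := hw1
    simp only [shiftPt]; push_cast; linarith
  obtain ⟨σ, hσ⟩ := hLp.joinedIn _ (mem_connectedComponentIn hLm) _ hwL
  obtain ⟨M, hM⟩ := isCompact_univ.exists_bound_of_continuousOn
    (f := fun t : unitInterval => (σ t).1) (continuous_fst.comp σ.continuous).continuousOn
  have hσM : ∀ s, -M ≤ (σ s).1 := fun s => (abs_le.mp (hM s trivial)).1
  have hσ0 : (σ 0).1 = -1/2 := by rw [σ.source]; rfl
  have hσ0' : ((σ 0).2 : ℝ) = 1 := by rw [σ.source]; rfl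
  have hM0 : -M ≤ -1/2 := by rw [← hσ0]; exact hσM 0
  refine ⟨-M - 1, by linarith, ?_⟩
  rintro k hk γ ⟨hγc, -, hγ0, hγV⟩ hγ1
  by_contra hRγ
  have hγR : ∀ t, (γ t).1 < R := by
    intro t
    by_contra hcon
    rw [not_lt] at hcon
    apply hRγ
    have hcc : Continuous fun t => (γ t).1 := continuous_fst.comp hγc
    exact mem_range_of_exists_le_of_exists_ge hcc ⟨1, by linarith⟩ ⟨t, hcon⟩
  have hγL : ∀ t, γ t ∉ Lf := fun t => hVk k hk _ (hγV t)
  set a := (γ 0).1 with ha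
  set x1 := (γ 1).1 with hx1
  set y1 : ℝ := ((γ 1).2 : ℝ) with hy1
  have ha0 : 0 ≤ a := by
    by_contra hcon
    rw [not_le] at hcon
    apply hγL 0
    have : γ 0 = tp a := Prod.ext rfl (Subtype.ext hγ0)
    rw [this]; exact hLtop a hcon
  let p : unitInterval → ℂ := fun t => emb (γ t)
  let c : unitInterval → ℂ := fun t =>
    ((x1 + (t : ℝ) * (a - x1) : ℝ) : ℂ) +
    ((y1 + (t : ℝ) * (1 - y1) + 3 * (a - x1) * (t : ℝ) * (1 - (t : ℝ)) : ℝ) : ℂ) * Complex.I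
  have hcre : ∀ t, (c t).re = x1 + (t : ℝ) * (a - x1) := by intro t; simp [c]
  have hcim : ∀ t, (c t).im = y1 + (t : ℝ) * (1 - y1) +
      3 * (a - x1) * (t : ℝ) * (1 - (t : ℝ)) := by intro t; simp [c]
  have hp : Continuous p := continuous_emb.comp hγc
  have hc : Continuous c := by fun_prop
  have h01 : p 1 = c 0 := by
    apply Complex.ext
    · rw [hcre]; simp [p, emb, hx1]
    · rw [hcim]; simp [p, emb, hy1]
  have h10 : c 1 = p 0 := by
    apply Complex.ext
    · rw [hcre]; simp [p, emb, ha]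
    · rw [hcim]; simp [p, emb, hγ0]
  have hy1' : -1 ≤ y1 := (γ 1).2.2.1
  have hhigh : ∀ t : unitInterval, -M ≤ (c t).re → t ≠ 1 → 1 < (c t).im := by
    intro t ht ht1
    have h1 : (t : ℝ) < 1 := lt_of_le_of_ne t.2.2 fun h => ht1 (Subtype.ext h)
    rw [hcre] at ht
    rw [hcim]
    have h2 : 1 ≤ (t : ℝ) * (a - x1) := by linarith
    nlinarith [mul_nonneg (sub_nonneg.mpr h1.le) (sub_nonneg.mpr h2),
      mul_nonneg (sub_nonneg.mpr h1.le) (show 0 ≤ 1 + y1 by linarith)]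
  have hpσ : ∀ t s, γ t ≠ σ s := fun t s h => hγL t (h ▸ hσ s)
  have hcσ : ∀ t s, c t ≠ emb (σ s) := by
    intro t s h
    by_cases ht : t = 1
    · rw [ht, h10] at h
      exact hpσ 0 s (emb_inj h)
    · have h1 := hhigh t (by rw [h]; exact hσM s) ht
      rw [h] at h1
      exact absurd (σ s).2.2.2 (not_le.mpr h1)
  have hor : ∀ s, WZ p c (emb (σ s)) ∨ WN p c (emb (σ s)) := fun s =>
    WZ_or_WN hp hc (fun t h => hpσ t s (emb_inj h)) (fun t h => hcσ t s h)
  have hσc : Continuous fun s => emb (σ s) := continuous_emb.comp σ.continuous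
  have hO : IsOpen {s | WN p c (emb (σ s))} := (isOpen_WN hp hc h01 h10).preimage hσc
  have hZ : IsOpen {s | WZ p c (emb (σ s))} := (isOpen_WZ hp hc h01 h10).preimage hσc
  have hcompl : {s | WN p c (emb (σ s))} = {s | WZ p c (emb (σ s))}ᶜ := by
    ext s
    exact ⟨fun h h' => WZ_WN h' h, fun h => (hor s).resolve_left h⟩
  have hN0 : WN p c (emb (σ 0)) := by
    refine WN_of_cross hp hc h01 h10 ?_ ?_ ?_ ?_
    · intro t ht
      have h1 : ((γ t).2 : ℝ) ≤ 1 := (γ t).2.2.2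
      change ((γ t).2 : ℝ) < ((σ 0).2 : ℝ)
      rw [hσ0']
      refine lt_of_le_of_ne h1 fun h => hpσ t 0 (Prod.ext ht (Subtype.ext ?_))
      rw [h, hσ0']
    · intro t ht
      change ((σ 0).2 : ℝ) < _
      rw [hσ0']
      have ht : (c t).re = -1/2 := by rw [ht]; exact hσ0
      refine hhigh t (by rw [ht]; exact hM0) ?_
      rintro rfl
      rw [hcre] at ht
      simp at ht
      linarith
    · change (σ 0).1 < a
      rw [hσ0]; linarith
    · change x1 < (σ 0).1
      rw [hσ0]; linarith
  have hcl : IsClopen {s | WN p c (emb (σ s))} := ⟨by rw [hcompl]; exact hZ.isClosed_compl, hO⟩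
  have huniv := hcl.eq_univ ⟨0, hN0⟩
  have hN1 : WN p c (emb (σ 1)) := by
    have : (1 : unitInterval) ∈ {s | WN p c (emb (σ s))} := by rw [huniv]; trivial
    exact this
  refine WZ_WN ?_ hN1
  have hσ1 : (emb (σ 1)).re = w.1 := by rw [σ.target]; rfl
  refine WZ_of_slit hp hc h01 h10 (k := -1) (by norm_num) ?_ ?_
  · intro t
    rw [Complex.mem_slitPlane_iff]; left
    have := hγR t
    have h2 : (p t).re = (γ t).1 := rfl
    simp only [neg_mul, one_mul, Complex.neg_re, Complex.sub_re, hσ1, h2]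
    linarith
  · intro t
    rw [Complex.mem_slitPlane_iff]; left
    have h0 := hγR 0
    simp only [neg_mul, one_mul, Complex.neg_re, Complex.sub_re, hσ1, hcre]
    have h3 : (t : ℝ) * (a - x1) ≤ 1 * (a - x1) :=
      mul_le_mul_of_nonneg_right t.2.2 (by linarith)
    linarith
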